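/- Let (A,B) be a mixed-4-separation⁺ in a 4-connected graph G with A \ B ≠ ∅ and such that no two edges in S(A,B) share an endvertex in B \ A. Let (A',B') denote the left-reduction of (A,B). Then the following assertions are equivalent: (1) (A',B') satisfies the matching-condition; (2) |A \ B| ≥ 2. -/

import Mathlib

open Set

namespace Paper

variable {V : Type*}

/-- The set of edges of `G` with one endvertex in `A \ B` and the other in `B \ A`. -/
def sepEdges (G : SimpleGraph V) (A B : Set V) : Set (Sym2 V) :=
  {e | e ∈ G.edgeSet ∧ ∃ a b : V, e = s(a, b) ∧ a ∈ A \ B ∧ b ∈ B \ A}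

/-- The order of the mixed-separation `(A, B)`: the number of vertices of `A ∩ B`
plus the number of edges between `A \ B` and `B \ A`. -/
noncomputable def sepOrder (G : SimpleGraph V) (A B : Set V) : ℕ∞ :=
  (A ∩ B).encard + (sepEdges G A B).encard

/-- A mixed-separation⁺: a pair of vertex sets covering the whole graph. -/
def IsMixedSepPlus (A B : Set V) : Prop := A ∪ B = Set.univ

/-- A (proper) mixed-separation. -/
def IsMixedSep (A B : Set V) : Prop :=
  A ∪ B = Set.univ ∧ (A \ B).Nonempty ∧ (B \ A).Nonempty

/-- `G` is `k`-connected: it has more than `k` vertices and deleting fewer than `k`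
vertices keeps it connected. -/
def KConnected (G : SimpleGraph V) (k : ℕ) : Prop :=
  (k : ℕ∞) < (Set.univ : Set V).encard ∧
    ∀ X : Set V, X.encard < (k : ℕ∞) → (G.induce (Xᶜ : Set V)).Connected

/-- Every vertex of `A ∩ B` has at least two neighbours in `A \ B`
and at least two neighbours in `B \ A`. -/
def DegreeCondition (G : SimpleGraph V) (A B : Set V) : Prop :=
  ∀ v ∈ A ∩ B,
    2 ≤ (G.neighborSet v ∩ (A \ B)).encard ∧ 2 ≤ (G.neighborSet v ∩ (B \ A)).encard

/-- No two edges in the separator of `(A,B)` share an endvertex. -/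
def MatchingCondition (G : SimpleGraph V) (A B : Set V) : Prop :=
  ∀ e ∈ sepEdges G A B, ∀ f ∈ sepEdges G A B, e ≠ f → ∀ v : V, v ∈ e → v ∉ f

/-- A tetra-separation. -/
def IsTetraSep (G : SimpleGraph V) (A B : Set V) : Prop :=
  IsMixedSep A B ∧ sepOrder G A B = 4 ∧ DegreeCondition G A B ∧ MatchingCondition G A B

/-- `(A,B) ≤ (C,D)`. -/
def LeSep (A B C D : Set V) : Prop := A ⊆ C ∧ D ⊆ B

/-- `(A,B)` and `(C,D)` are nested. -/
def Nested (A B C D : Set V) : Prop :=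
  LeSep A B C D ∨ LeSep A B D C ∨ LeSep B A C D ∨ LeSep B A D C

/-- `(A,B)` and `(C,D)` cross. -/
def Crosses (A B C D : Set V) : Prop := ¬ Nested A B C D

/-- The corner for the sides `A` and `C` of the pair `(A,B)`, `(C,D)`. -/
def corner (A B C D : Set V) : Set V := (A \ B) ∩ (C \ D)

/-- The vertex-centre of the crossing-diagram of `(A,B)` and `(C,D)`. -/
def vertexCentre (A B C D : Set V) : Set V := A ∩ B ∩ C ∩ D

/-- An edge is diagonal if its endvertices lie in opposite corners. -/
def IsDiagonal (G : SimpleGraph V) (A B C D : Set V) (e : Sym2 V) : Prop :=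
  e ∈ G.edgeSet ∧ ∃ a b : V, e = s(a, b) ∧
    ((a ∈ corner A B C D ∧ b ∈ corner B A D C) ∨
     (a ∈ corner A B D C ∧ b ∈ corner B A C D))

/-- The `C`-link of the crossing diagram of `(A,B)` and `(C,D)`: all non-diagonal
edges of `S(A,B)` with an endvertex in the corner for `AC` or for `BC`, together with
all vertices of `(C \ D) ∩ S(A,B)`.  (The `D`-link is `link G A B D C`, the `A`-link
is `link G C D A B`, the `B`-link is `link G C D B A`.) -/
def link (G : SimpleGraph V) (A B C D : Set V) : Set (V ⊕ Sym2 V) :=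
  Sum.inl '' ((C \ D) ∩ (A ∩ B)) ∪
    Sum.inr '' {e | e ∈ sepEdges G A B ∧ ¬ IsDiagonal G A B C D e ∧
      ∃ v : V, v ∈ e ∧ (v ∈ corner A B C D ∨ v ∈ corner B A C D)}

/-- The centre: the vertex-centre together with all diagonal edges. -/
def centre (G : SimpleGraph V) (A B C D : Set V) : Set (V ⊕ Sym2 V) :=
  Sum.inl '' vertexCentre A B C D ∪ Sum.inr '' {e | IsDiagonal G A B C D e}

/-- The corner-separator `L(A,C)`: the union of the `A`-link, the `C`-link, the
vertex-centre and the diagonal edges with an endvertex in the corner for `AC`. -/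
def cornerSep (G : SimpleGraph V) (A B C D : Set V) : Set (V ⊕ Sym2 V) :=
  link G C D A B ∪ link G A B C D ∪ Sum.inl '' vertexCentre A B C D ∪
    Sum.inr '' {e | IsDiagonal G A B C D e ∧ ∃ v : V, v ∈ e ∧ v ∈ corner A B C D}

/-- An edge is jumping if its endvertices lie in opposite links. -/
def IsJumping (G : SimpleGraph V) (A B C D : Set V) (e : Sym2 V) : Prop :=
  e ∈ G.edgeSet ∧ ∃ a b : V, e = s(a, b) ∧
    ((Sum.inl a ∈ link G C D A B ∧ Sum.inl b ∈ link G C D B A) ∨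
     (Sum.inl a ∈ link G A B C D ∧ Sum.inl b ∈ link G A B D C))

/-- An edge dangles from `fromLink` through `throughLink` if it has an endvertex
that is a vertex of `fromLink` and the edge itself is an element of `throughLink`. -/
def DanglesFromThrough (G : SimpleGraph V) (fromLink throughLink : Set (V ⊕ Sym2 V))
    (e : Sym2 V) : Prop :=
  e ∈ G.edgeSet ∧ (∃ v : V, v ∈ e ∧ Sum.inl v ∈ fromLink) ∧ Sum.inr e ∈ throughLink

/-- The corner for `A` and `C` is potter. -/
def Potter (G : SimpleGraph V) (A B C D : Set V) : Prop :=
  corner A B C D = ∅ ∧ (link G C D A B).encard = 2 ∧ (link G A B C D).encard = 2 ∧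
    ∃ u₁ u₂ u₃ u₄ : V, G.Adj u₁ u₂ ∧ G.Adj u₂ u₃ ∧ G.Adj u₃ u₄ ∧
      List.Nodup [u₁, u₂, u₃, u₄] ∧
      Sum.inl u₂ ∈ link G A B C D ∧ Sum.inr (s(u₁, u₂)) ∈ link G C D A B ∧
      Sum.inl u₃ ∈ link G C D A B ∧ Sum.inr (s(u₃, u₄)) ∈ link G A B C D

/-- All four links have size two and the centre is empty. -/
def LinksTwoCentreEmpty (G : SimpleGraph V) (A B C D : Set V) : Prop :=
  (link G C D A B).encard = 2 ∧ (link G C D B A).encard = 2 ∧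
    (link G A B C D).encard = 2 ∧ (link G A B D C).encard = 2 ∧
    centre G A B C D = ∅

/-- `(A,B)` is half-connected. -/
def HalfConnected (G : SimpleGraph V) (A B : Set V) : Prop :=
  (G.induce (A \ B)).Connected ∨ (G.induce (B \ A)).Connected

/-- First component of the left-reduction of `(A,B)`: delete from `A` the vertices of
`A ∩ B` with at most one neighbour in `A \ B`.  (The left-reduction of `(A,B)` is
`(leftRed G A B, B)`; the right-reduction is `(A, leftRed G B A)`.) -/
def leftRed (G : SimpleGraph V) (A B : Set V) : Set V :=
  A \ {v | v ∈ A ∩ B ∧ (G.neighborSet v ∩ (A \ B)).encard ≤ 1}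

/-- The separator of `(A,B)` as a set of vertices and edges. -/
def sepElems (G : SimpleGraph V) (A B : Set V) : Set (V ⊕ Sym2 V) :=
  Sum.inl '' (A ∩ B) ∪ Sum.inr '' sepEdges G A B

/-- `x̂`: the endvertices of an element of the separator. -/
def hat : V ⊕ Sym2 V → Set V
  | Sum.inl v => {v}
  | Sum.inr e => {w | w ∈ e}

/-- `X̂` for a set `X` of vertices and edges. -/
def hatSet (π : Set (V ⊕ Sym2 V)) : Set V := ⋃ x ∈ π, hat x

/-- Inner vertices of a walk. -/
def innerVerts (G : SimpleGraph V) {u v : V} (p : G.Walk u v) : Set V :=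
  {w | w ∈ p.support ∧ w ≠ u ∧ w ≠ v}

/-- An `X`–`Y` path: a path starting in `X`, ending in `Y`, with no other
vertex in `X ∪ Y`. -/
def IsXYPath (G : SimpleGraph V) (X Y : Set V) {u v : V} (p : G.Walk u v) : Prop :=
  p.IsPath ∧ u ∈ X ∧ v ∈ Y ∧ ∀ w ∈ p.support, w ∈ X ∪ Y → w = u ∨ w = v

/-- A walk avoids a vertex (it is not on the walk) or an edge (it is not used). -/
def WalkAvoids (G : SimpleGraph V) {u v : V} (p : G.Walk u v) (x : V ⊕ Sym2 V) : Prop :=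
  Sum.elim (fun w => w ∉ p.support) (fun e => e ∉ p.edges) x

/-- There are `n` pairwise independent `X`–`Y` paths in `G`
(no path contains an inner vertex of another). -/
def HasIndepPaths (G : SimpleGraph V) (X Y : Set V) (n : ℕ) : Prop :=
  ∃ (a b : Fin n → V) (p : ∀ i, G.Walk (a i) (b i)),
    (∀ i, IsXYPath G X Y (p i)) ∧
      ∀ i j, i ≠ j → ∀ w ∈ innerVerts G (p i), w ∉ (p j).support

/-- Maximum number of pairwise independent `X`–`Y` paths in `G`. -/
noncomputable def maxIndepPaths (G : SimpleGraph V) (X Y : Set V) : ℕ∞ :=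
  sSup {n : ℕ∞ | ∃ m : ℕ, n = (m : ℕ∞) ∧ HasIndepPaths G X Y m}

/-- `(A,B)` strongly separates `X` and `Y`. -/
def StronglySeparates (A B X Y : Set V) : Prop := X ⊆ A \ B ∧ Y ⊆ B \ A

/-- Minimum order of a mixed-separation of `G` strongly separating `X` and `Y`. -/
noncomputable def minSepOrder (G : SimpleGraph V) (X Y : Set V) : ℕ∞ :=
  sInf {n : ℕ∞ | ∃ A B : Set V,
    IsMixedSep A B ∧ StronglySeparates A B X Y ∧ sepOrder G A B = n}

/-- A `k`-separation: a mixed-separation of order `k` whose separator has no edges. -/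
def IsVertexSep (G : SimpleGraph V) (A B : Set V) (k : ℕ) : Prop :=
  IsMixedSep A B ∧ sepEdges G A B = ∅ ∧ sepOrder G A B = (k : ℕ∞)

/-- `G` is quasi-`k`-connected: `(k-1)`-connected and every `(k-1)`-separation has a
side whose proper part is a single vertex. -/
def QuasiConnected (G : SimpleGraph V) (k : ℕ) : Prop :=
  KConnected G (k - 1) ∧
    ∀ A B : Set V, IsVertexSep G A B (k - 1) →
      (A \ B).encard = 1 ∨ (B \ A).encard = 1

/-- `{x₁,x₂}` is 3-linked around the separator `{x₁,x₂,x₃,x₄}`. -/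
def ThreeLinkedAround (G : SimpleGraph V) (x₁ x₂ x₃ x₄ : V ⊕ Sym2 V) : Prop :=
  (∃ e : Sym2 V, x₃ = Sum.inr e) ∨ (∃ e : Sym2 V, x₄ = Sum.inr e) ∨
    (((∃ v : V, x₁ = Sum.inl v) ∨ (∃ v : V, x₂ = Sum.inl v)) ∧
      ∃ a b : V, G.Adj a b ∧ a ∈ hat x₁ ∧ b ∈ hat x₂) ∨
    (∃ (a b : Fin 3 → V) (p : ∀ i, G.Walk (a i) (b i)),
      (∀ i, IsXYPath G (hat x₁) (hat x₂) (p i) ∧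
        WalkAvoids G (p i) x₃ ∧ WalkAvoids G (p i) x₄) ∧
      ∀ i j, i ≠ j → ∀ w ∈ innerVerts G (p i), w ∉ (p j).support)

/-- `G` is 4-angry: 4-connected and every tetra-separation is crossed. -/
def FourAngry (G : SimpleGraph V) : Prop :=
  KConnected G 4 ∧
    ∀ A B : Set V, IsTetraSep G A B → ∃ C D : Set V, IsTetraSep G C D ∧ Crosses A B C D

/-- `G` is a sprinkled `K₄,ₘ`: a set `X` of four vertices, whose complement has
exactly `m` elements, is independent and completely joined to `X`
(edges inside `X` arbitrary). -/
def IsSprinkledK4m (G : SimpleGraph V) (m : ℕ∞) : Prop :=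
  ∃ X : Set V, X.encard = 4 ∧ (Xᶜ : Set V).encard = m ∧
    (∀ a b : V, a ∉ X → b ∉ X → ¬ G.Adj a b) ∧
    ∀ a : V, a ∉ X → ∀ x ∈ X, G.Adj a x

/-- If `X` has fewer than `k` vertices in a `k`-connected graph, then no vertex set is closed
under adjacency outside `X` unless it contains all or none of the vertices outside `X`. -/
lemma KConnected.mem_of_closed {G : SimpleGraph V} {k : ℕ} (hG : KConnected G k) {X W : Set V}
    (hX : X.encard < (k : ℕ∞)) (hW : ∀ u ∈ W, u ∉ X → ∀ y, y ∉ X → G.Adj u y → y ∈ W)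
    {w b : V} (hw : w ∈ W) (hwX : w ∉ X) (hbX : b ∉ X) : b ∈ W := by
  obtain ⟨p⟩ := (hG.2 X hX).preconnected ⟨w, hwX⟩ ⟨b, hbX⟩
  have key : ∀ {x y : (Xᶜ : Set V)}, (G.induce (Xᶜ : Set V)).Walk x y →
      (x : V) ∈ W → (y : V) ∈ W := by
    intro x y p
    induction p with
    | nil => exact id
    | @cons u v _ h _ ih => exact fun hx => ih (hW u hx u.2 v v.2 h)
  exact key p hw

/-- In a `k`-connected graph every vertex has at least `k` neighbours. -/
lemma KConnected.le_encard_neighborSet {G : SimpleGraph V} {k : ℕ} (hG : KConnected G k) (a : V) :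
    (k : ℕ∞) ≤ (G.neighborSet a).encard := by
  by_contra! hlt
  have hsub : (Set.univ : Set V) ⊆ insert a (G.neighborSet a) := by
    intro z _
    by_cases hz : z ∈ G.neighborSet a
    · exact Or.inr hz
    · refine Or.inl (hG.mem_of_closed (W := {a}) hlt ?_ rfl (G.irrefl ·) hz)
      rintro u rfl - y hy hadj
      exact absurd hadj hy
  have h1 := (encard_le_encard hsub).trans (encard_insert_le _ _)
  have h2 := h1.trans (Order.add_one_le_of_lt hlt)
  exact absurd hG.1 (not_lt.mpr h2)

lemma leftRed_diff (G : SimpleGraph V) (A B : Set V) : leftRed G A B \ B = A \ B := by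
  ext x
  simp only [leftRed, mem_sdiff, mem_ofPred_eq, mem_inter_iff]
  tauto

lemma mk_mem_sepEdges {G : SimpleGraph V} {A B : Set V} {a b : V} (hadj : G.Adj a b)
    (ha : a ∈ A \ B) (hb : b ∈ B \ A) : s(a, b) ∈ sepEdges G A B :=
  ⟨hadj, a, b, rfl, ha, hb⟩

/-- A deleted vertex has at most one neighbour in `A \ B`. -/
lemma eq_of_adj_of_notMem_leftRed {G : SimpleGraph V} {A B : Set V} {a a' y : V}
    (hy : y ∈ A ∩ B) (hy' : y ∉ leftRed G A B) (ha : a ∈ A \ B) (ha' : a' ∈ A \ B)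
    (h : G.Adj a y) (h' : G.Adj a' y) : a = a' := by
  have hle : (G.neighborSet y ∩ (A \ B)).encard ≤ 1 := by
    by_contra hc
    exact hy' ⟨hy.1, fun hm => hc hm.2⟩
  exact encard_le_one_iff.mp hle a a' ⟨h.symm, ha⟩ ⟨h'.symm, ha'⟩

/-- The left-reduction does not increase the order. -/
lemma sepOrder_leftRed_le (G : SimpleGraph V) (A B : Set V) :
    sepOrder G (leftRed G A B) B ≤ sepOrder G A B := by
  set A' := leftRed G A B
  have hsubA : A' ⊆ A := sdiff_subset
  have hd : A' \ B = A \ B := leftRed_diff G A B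
  have hend : ∀ e ∈ sepEdges G A' B \ sepEdges G A B,
      ∃ a y, e = s(a, y) ∧ G.Adj a y ∧ a ∈ A \ B ∧ y ∈ A ∩ B ∧ y ∉ A' := by
    rintro _ ⟨⟨he, a, y, rfl, ha, hy⟩, hn⟩
    rw [hd] at ha
    exact ⟨a, y, rfl, he, ha,
      ⟨by_contra fun hyA => hn (mk_mem_sepEdges he ha ⟨hy.1, hyA⟩), hy.1⟩, hy.2⟩
  have hinj : (sepEdges G A' B \ sepEdges G A B).encard ≤ ((A ∩ B) \ (A' ∩ B)).encard := by
    rcases isEmpty_or_nonempty V with hV | hV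
    · simp [eq_empty_of_isEmpty]
    choose! f g hfg using hend
    refine encard_le_encard_of_injOn (f := g) (fun e he => ?_) fun e he e' he' h => ?_
    · exact ⟨(hfg e he).2.2.2.1, fun hm => (hfg e he).2.2.2.2 hm.1⟩
    · obtain ⟨h1, h2, h3, h4, h5⟩ := hfg e he
      obtain ⟨k1, k2, k3, k4, k5⟩ := hfg e' he'
      rw [← h] at k1 k2
      rw [h1, k1, eq_of_adj_of_notMem_leftRed h4 h5 h3 k3 h2 k2]
  calc sepOrder G A' B
      ≤ (A' ∩ B).encard + ((sepEdges G A' B \ sepEdges G A B).encard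
          + (sepEdges G A B).encard) := by
        refine add_le_add_right ?_ _
        refine (encard_le_encard (t := (sepEdges G A' B \ sepEdges G A B) ∪ sepEdges G A B)
          ?_).trans (encard_union_le _ _)
        rw [sdiff_union_self]
        exact subset_union_left
    _ ≤ (A' ∩ B).encard + (((A ∩ B) \ (A' ∩ B)).encard + (sepEdges G A B).encard) := by gcongr
    _ = sepOrder G A B := by
        rw [sepOrder, ← add_assoc, add_comm (A' ∩ B).encard,
          encard_sdiff_add_encard_of_subset (inter_subset_inter_left B hsubA)]

/-- In a `4`-connected graph, two separator edges of a mixed-separation of order at most `4`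
cannot share an endvertex in `A \ B`, provided `A \ B` has another vertex and no two separator
edges share an endvertex in `B \ A`. -/
lemma KConnected.false_of_adj_of_adj {G : SimpleGraph V} (hG : KConnected G 4) {A B : Set V}
    (hplus : IsMixedSepPlus A B) (hord : sepOrder G A B ≤ 4)
    (hB : ∀ a ∈ A \ B, ∀ a' ∈ A \ B, ∀ y ∈ B \ A, G.Adj a y → G.Adj a' y → a = a')
    {v w b c : V} (hv : v ∈ A \ B) (hw : w ∈ A \ B) (hwv : w ≠ v) (hb : b ∈ B \ A)
    (hc : c ∈ B \ A) (hbc : b ≠ c) (hvb : G.Adj v b) (hvc : G.Adj v c) : False := by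
  set E := sepEdges G A B
  set P : Set (Sym2 V) := {s(v, b), s(v, c)}
  have hsel : ∀ e ∈ E \ P, ∃ x, x ∈ e ∧ x ≠ w ∧ x ≠ b := by
    rintro _ ⟨⟨he, a, y, rfl, ha, hy⟩, hn⟩
    by_cases haw : a = w
    · refine ⟨y, Sym2.mem_mk_right _ _, ?_, ?_⟩
      · rintro rfl; exact hw.2 hy.1
      · rintro rfl
        exact hn (Or.inl (by rw [hB a ha v hv y hy he hvb]))
    · refine ⟨a, Sym2.mem_mk_left _ _, haw, ?_⟩
      rintro rfl; exact ha.2 hb.1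
  have : Nonempty V := ⟨v⟩
  choose! h hh using hsel
  have hPE : P ⊆ E := by
    rintro _ (rfl | rfl)
    · exact mk_mem_sepEdges hvb hv hb
    · exact mk_mem_sepEdges hvc hv hc
  have hP2 : P.encard = 2 := encard_pair fun h => hbc (Sym2.congr_right.mp h)
  have hcard : (E \ P).encard + 2 = E.encard := by
    rw [← hP2, encard_sdiff_add_encard_of_subset hPE]
  set X : Set V := {v} ∪ ((A ∩ B) ∪ h '' (E \ P))
  have hX4 : X.encard < ((4 : ℕ) : ℕ∞) := by
    have h1 : X.encard ≤ 1 + ((A ∩ B).encard + (E \ P).encard) := by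
      refine (encard_union_le _ _).trans ?_
      rw [encard_singleton]
      gcongr
      exact (encard_union_le _ _).trans (by gcongr; exact encard_image_le _ _)
    have h2 : (A ∩ B).encard + ((E \ P).encard + 2) ≤ 4 := by rw [hcard]; exact hord
    refine h1.trans_lt ?_
    generalize (A ∩ B).encard = p at h2 ⊢
    generalize (E \ P).encard = q at h2 ⊢
    have hp : p ≠ ⊤ := by rintro rfl; simp at h2
    have hq : q ≠ ⊤ := by rintro rfl; simp at h2
    lift p to ℕ using hp
    lift q to ℕ using hq
    norm_cast at h2 ⊢
    omega
  have hwX : w ∉ X := by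
    rintro (h1 | h1 | ⟨e, he, rfl⟩)
    · exact hwv h1
    · exact hw.2 h1.2
    · exact (hh e he).2.1 rfl
  have hbX : b ∉ X := by
    rintro (h1 | h1 | ⟨e, he, rfl⟩)
    · exact hvb.ne h1.symm
    · exact hb.2 h1.1
    · exact (hh e he).2.2 rfl
  refine (hG.mem_of_closed (W := A \ B) hX4 ?_ hw hwX hbX).2 hb.1
  intro u hu huX y hyX hadj
  by_contra hyW
  have hyAB : y ∈ A ∪ B := hplus ▸ mem_univ y
  have hyB : y ∈ B := by
    by_contra hyB
    exact hyW ⟨hyAB.resolve_right hyB, hyB⟩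
  have hyA : y ∉ A := fun hyA => hyX (Or.inr (Or.inl ⟨hyA, hyB⟩))
  have heE : s(u, y) ∈ E := mk_mem_sepEdges hadj hu ⟨hyB, hyA⟩
  by_cases heP : s(u, y) ∈ P
  · have hvm : v ∈ s(u, y) := by
      rcases heP with h1 | h1 <;> rw [h1] <;> exact Sym2.mem_mk_left _ _
    rcases Sym2.mem_iff.mp hvm with rfl | rfl
    · exact huX (Or.inl rfl)
    · exact hyX (Or.inl rfl)
  · have hm : h s(u, y) ∈ X := Or.inr (Or.inr ⟨_, ⟨heE, heP⟩, rfl⟩)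
    rcases Sym2.mem_iff.mp (hh _ ⟨heE, heP⟩).1 with h1 | h1 <;> rw [h1] at hm
    · exact huX hm
    · exact hyX hm

/-- when the left-reduction satisfies the matching-condition. -/
theorem left_matching_medium (G : SimpleGraph V) (A B : Set V)
    (hG : KConnected G 4) (hplus : IsMixedSepPlus A B) (hord : sepOrder G A B = 4)
    (hne : (A \ B).Nonempty)
    (hnoshare : ∀ e ∈ sepEdges G A B, ∀ f ∈ sepEdges G A B, e ≠ f →
        ∀ v ∈ B \ A, ¬ (v ∈ e ∧ v ∈ f)) :
    MatchingCondition G (leftRed G A B) B ↔ 2 ≤ (A \ B).encard := by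
  set A' := leftRed G A B
  have hd : A' \ B = A \ B := leftRed_diff G A B
  have hplus' : IsMixedSepPlus A' B := by
    rw [IsMixedSepPlus, ← sdiff_union_self, hd, sdiff_union_self]
    exact hplus
  constructor
  · intro hM
    by_contra! hlt
    obtain ⟨a, haAB⟩ := encard_eq_one.mp
      (le_antisymm (Order.le_of_lt_add_one (by simpa [one_add_one_eq_two] using hlt))
        (one_le_encard_iff_nonempty.mpr hne))
    have ha : a ∈ A' \ B := by rw [hd, haAB]; rfl
    have hnb : ∀ y, G.Adj a y → s(a, y) ∈ sepEdges G A' B := by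
      intro y hy
      have hyAB : y ∉ A \ B := by
        rw [haAB]
        exact hy.ne'
      have hyB : y ∈ B := by
        have : y ∈ A ∪ B := hplus ▸ mem_univ y
        by_contra hyB
        exact hyAB ⟨this.resolve_right hyB, hyB⟩
      refine mk_mem_sepEdges hy ha ⟨hyB, fun hyA' => hyA'.2 ⟨⟨hyA'.1, hyB⟩, ?_⟩⟩
      rw [haAB]
      exact (encard_le_encard inter_subset_right).trans (encard_singleton a).le
    have h2 : 1 < (G.neighborSet a).encard :=
      lt_of_lt_of_le (by norm_num) (hG.le_encard_neighborSet a)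
    obtain ⟨b, c, hb, hc, hbc⟩ := one_lt_encard_iff.mp h2
    exact hM _ (hnb b hb) _ (hnb c hc) (fun h => hbc (Sym2.congr_right.mp h)) a
      (Sym2.mem_mk_left _ _) (Sym2.mem_mk_left _ _)
  · intro h2
    have hB : ∀ a ∈ A' \ B, ∀ a' ∈ A' \ B, ∀ y ∈ B \ A', G.Adj a y → G.Adj a' y → a = a' := by
      rw [hd]
      intro a ha a' ha' y hy hadj hadj'
      by_cases hyA : y ∈ A
      · exact eq_of_adj_of_notMem_leftRed ⟨hyA, hy.1⟩ hy.2 ha ha' hadj hadj'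
      · by_contra hne'
        refine hnoshare _ (mk_mem_sepEdges hadj ha ⟨hy.1, hyA⟩) _
          (mk_mem_sepEdges hadj' ha' ⟨hy.1, hyA⟩) (fun h => hne' ?_) y ⟨hy.1, hyA⟩
          ⟨Sym2.mem_mk_right _ _, Sym2.mem_mk_right _ _⟩
        exact Sym2.congr_left.mp h
    have hord' : sepOrder G A' B ≤ 4 := (sepOrder_leftRed_le G A B).trans hord.le
    rintro _ ⟨he, a, b, rfl, ha, hb⟩ _ ⟨hf, a', c, rfl, ha', hc⟩ hef v hve hvf
    rcases Sym2.mem_iff.mp hve with rfl | rfl <;> rcases Sym2.mem_iff.mp hvf with rfl | rfl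
    · obtain ⟨w, hw, hwv⟩ := exists_ne_of_one_lt_encard
        (lt_of_lt_of_le (by norm_num) h2) v
      exact hG.false_of_adj_of_adj hplus' hord' hB ha (hd ▸ hw) hwv hb hc
        (fun h => hef (by rw [h])) he hf
    · exact ha.2 hc.1
    · exact ha'.2 hb.1
    · exact hef (by rw [hB a ha a' ha' v hb he hf])
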